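/- In the q-shuffle algebra V on letters x, y, define W_{−k} = (xy)^k x and G̃ₖ = (xy)^k (concatenation, G̃₀ = 1). Then for every natural number n, Σ_{k=0}^{2n} (−1)^k W_{−k} ⋆ G̃_{2n−k} = (−1)^n [2]_q^{2n} (xxyy)^n x = Σ_{k=0}^{2n} (−1)^k G̃_{2n−k} ⋆ W_{−k}, where [2]_q = q + q^{-1}. -/

import Mathlib

noncomputable section

/-- The letter `x`. -/
def bX : Bool := false
/-- The letter `y`. -/
def bY : Bool := true

/-- The bilinear pairing on letters: `⟨x,x⟩ = ⟨y,y⟩ = 2`, `⟨x,y⟩ = ⟨y,x⟩ = -2`. -/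
def qbr (a b : Bool) : ℤ := if a = b then 2 else -2

/-- The sum `⟨a, w₁⟩ + ⋯ + ⟨a, wₙ⟩` for a letter `a` and a word `w`. -/
def qE (a : Bool) (w : List Bool) : ℤ := (w.map (qbr a)).sum

/-- Linear map on the free algebra (words-indexed finsupps) given by prepending a letter. -/
def qcons (F : Type*) [Field F] (a : Bool) :
    (List Bool →₀ F) →ₗ[F] (List Bool →₀ F) :=
  Finsupp.lmapDomain F F (List.cons a)

/-- The q-shuffle product of two words, as an element of the free algebra `List Bool →₀ F`.
Defined by the recursion `u ⋆ v = u₁((u₂⋯u_r) ⋆ v) + q^{⟨v₁,u₁⟩+⋯+⟨v₁,u_r⟩} v₁(u ⋆ (v₂⋯v_s))`. -/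
def qsh {F : Type*} [Field F] (q : F) : List Bool → List Bool → (List Bool →₀ F)
  | [], v => Finsupp.single v 1
  | a :: u, [] => Finsupp.single (a :: u) 1
  | a :: u, b :: v =>
      qcons F a (qsh q u (b :: v)) +
        (q ^ (qbr b a + qE b u)) • qcons F b (qsh q (a :: u) v)
  termination_by u v => u.length + v.length
  decreasing_by all_goals (simp only [List.length_cons]; omega)

/-- Concatenation power of a word. -/
def wpow (w : List Bool) : ℕ → List Bool
  | 0 => []
  | n + 1 => w ++ wpow w n

def wXXYY : List Bool := [bX, bX, bY, bY]
def wYYXX : List Bool := [bY, bY, bX, bX]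
def wXY : List Bool := [bX, bY]
def wYX : List Bool := [bY, bX]

open Finset in
theorem absRec {F V : Type*} [Field F] [AddCommGroup V] [Module F V] (X Y : V →ₗ[F] V)
    (p : F) (hp : p ≠ 0) (a b c d : ℕ → ℕ → V)
    (ha : ∀ k m, a k m = X (b k m) + p • X (c k m))
    (hb : ∀ k m, b (k+1) m = Y (a k m) + X (d (k+1) m))
    (hb0 : ∀ m, b 0 (m+1) = X (d 0 (m+1)))
    (hc0 : ∀ k, c k 0 = 0)
    (hc : ∀ k m, c k (m+1) = X (d k (m+1)) + p⁻¹ • Y (a k m))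
    (hd0 : ∀ k, d k 0 = 0)
    (hd1 : ∀ m, d 0 (m+1) = Y (b 0 m))
    (hd : ∀ k m, d (k+1) (m+1) = Y (c k (m+1)) + Y (b (k+1) m))
    (n : ℕ) :
    ∑ t ∈ antidiagonal (n+2), (-1 : F)^t.1 • a t.1 t.2 =
      (-((1+p)*(1+p⁻¹))) • X (X (Y (Y (∑ t ∈ antidiagonal n, (-1 : F)^t.1 • a t.1 t.2)))) := by
  set S : (ℕ → ℕ → V) → ℕ → V := fun f n => ∑ t ∈ antidiagonal n, (-1 : F)^t.1 • f t.1 t.2 with hS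
  have hA : ∀ n, S a n = X (S b n) + p • X (S c n) := by
    intro n
    simp only [hS, map_sum, smul_sum, ← sum_add_distrib, map_smul]
    refine sum_congr rfl fun t _ => ?_
    rw [ha, smul_add, smul_comm p]
  have hB : ∀ n, S b (n+1) = X (S d (n+1)) - Y (S a n) := by
    intro n
    simp only [hS, Nat.sum_antidiagonal_succ, hb, hb0, map_add, map_sum, map_smul, smul_add,
      sum_add_distrib, pow_succ, mul_neg, mul_one, neg_smul, sum_neg_distrib, map_neg]
    abel
  have hC : ∀ n, S c (n+1) = X (S d (n+1)) + p⁻¹ • Y (S a n) := by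
    intro n
    simp only [hS, Nat.sum_antidiagonal_succ', hc, hc0, hd0, map_add, map_sum, map_smul, smul_add,
      sum_add_distrib, smul_zero, map_zero, smul_sum]
    simp only [smul_comm p⁻¹]
    abel
  have hD : ∀ n, S d (n+1) = Y (S b n) - Y (S c n) := by
    intro n
    have h1 : S d (n+1) = ∑ t ∈ antidiagonal n, (-1 : F)^t.1 • d t.1 (t.2+1) := by
      simp only [hS, Nat.sum_antidiagonal_succ', hd0, smul_zero, zero_add]
    rw [h1]
    cases n with
    | zero => simp [hS, hd1, hc0]
    | succ n =>
      have h2 : S c (n+1) = ∑ t ∈ antidiagonal n, (-1 : F)^t.1 • c t.1 (t.2+1) := by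
        simp only [hS, Nat.sum_antidiagonal_succ', hc0, smul_zero, zero_add]
      rw [h2]
      simp only [hS, Nat.sum_antidiagonal_succ, hd1, hd, map_add, map_sum, map_smul, smul_add,
        sum_add_distrib, pow_succ, mul_neg, mul_one, neg_smul, sum_neg_distrib, map_neg]
      abel
  change S a (n+2) = _ • X (X (Y (Y (S a n))))
  rw [hA, hB, hC, hD, hB, hC]
  simp only [map_add, map_sub, map_smul]
  rw [hA (n+1), hB, hC]
  simp only [map_add, map_sub, map_smul, smul_add, smul_sub, smul_smul, mul_inv_cancel₀ hp]
  match_scalars <;> field_simp <;> ring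

theorem wXY_snoc (k : ℕ) : wpow wXY k ++ [bX] = bX :: wpow wYX k := by
  induction k with
  | zero => rfl
  | succ k ih => simp [wpow, wXY, wYX, ih] at *

theorem qE_XY (b : Bool) (k : ℕ) : qE b (wpow wXY k) = 0 := by
  induction k with
  | zero => rfl
  | succ k ih => cases b <;> simp_all [qE, wpow, wXY, qbr, bX, bY]

theorem qE_YX (b : Bool) (k : ℕ) : qE b (wpow wYX k) = 0 := by
  induction k with
  | zero => rfl
  | succ k ih => cases b <;> simp_all [qE, wpow, wYX, qbr, bX, bY]

theorem qE_cons (b a : Bool) (w : List Bool) : qE b (a :: w) = qbr b a + qE b w := by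
  simp [qE]

theorem wXY_succ (k : ℕ) : wpow wXY (k+1) = bX :: bY :: wpow wXY k := rfl
theorem wYX_succ (k : ℕ) : wpow wYX (k+1) = bY :: bX :: wpow wYX k := rfl

section
variable {F : Type*} [Field F] (q : F)

theorem qsh_nil_right (u : List Bool) : qsh q u [] = Finsupp.single u 1 := by
  cases u <;> simp [qsh]

theorem qcons_single (a : Bool) (u : List Bool) (r : F) :
    qcons F a (Finsupp.single u r) = Finsupp.single (a :: u) r := by
  simp [qcons]

theorem qbrXX : qbr bX bX = 2 := rfl
theorem qbrYY : qbr bY bY = 2 := rfl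
theorem qbrXY : qbr bX bY = -2 := rfl
theorem qbrYX : qbr bY bX = -2 := rfl

theorem qsh_nil_left (v : List Bool) : qsh q [] v = Finsupp.single v 1 := by
  simp [qsh]

theorem qsh_cons (a b : Bool) (u v : List Bool) : qsh q (a :: u) (b :: v) =
      qcons F a (qsh q u (b :: v)) +
        (q ^ (qbr b a + qE b u)) • qcons F b (qsh q (a :: u) v) := by
  rw [qsh]

/-- The common conclusion. -/
theorem finish (hq : q ≠ 0) (p : F) (hp : (1+p)*(1+p⁻¹) = (q+q⁻¹)^2) (A : ℕ → List Bool →₀ F)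
    (h0 : A 0 = Finsupp.single [bX] 1)
    (h : ∀ n, A (n+2) = (-((1+p)*(1+p⁻¹))) •
      qcons F bX (qcons F bX (qcons F bY (qcons F bY (A n))))) (n : ℕ) :
    A (2*n) = ((-1 : F) ^ n * (q + q⁻¹) ^ (2 * n)) •
          Finsupp.single (wpow wXXYY n ++ [bX]) (1 : F) := by
  induction n with
  | zero => simp [h0, wpow]
  | succ n ih =>
    rw [show 2*(n+1) = 2*n+2 by ring, h, ih, hp]
    simp only [map_smul, qcons_single, smul_smul]
    congr 1
    ring

theorem part1 (hq : q ≠ 0) (n : ℕ) :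
    ∑ t ∈ Finset.HasAntidiagonal.antidiagonal (n+2), (-1 : F)^t.1 • qsh q (bX :: wpow wYX t.1) (wpow wXY t.2) =
      (-((1+q^2)*(1+(q^2)⁻¹))) • qcons F bX (qcons F bX (qcons F bY (qcons F bY
      (∑ t ∈ Finset.HasAntidiagonal.antidiagonal n, (-1 : F)^t.1 • qsh q (bX :: wpow wYX t.1) (wpow wXY t.2))))) := by
  have hz : q ^ (-2 : ℤ) = (q^2)⁻¹ := by rw [zpow_neg]; norm_cast
  have hz2 : q ^ (2 : ℤ) = q^2 := by norm_cast
  refine absRec (qcons F bX) (qcons F bY) (q^2) (pow_ne_zero 2 hq)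
    (fun k m => qsh q (bX :: wpow wYX k) (wpow wXY m))
    (fun k m => qsh q (wpow wYX k) (wpow wXY m))
    (fun k m => match m with
      | 0 => 0
      | m+1 => qsh q (bX :: wpow wYX k) (bY :: wpow wXY m))
    (fun k m => match m with
      | 0 => 0
      | m+1 => qsh q (wpow wYX k) (bY :: wpow wXY m))
    ?_ ?_ ?_ ?_ ?_ ?_ ?_ ?_ n
  · rintro k (_ | m)
    · simp [wpow, qsh_nil_right, qcons_single]
    · simp only [wXY_succ, qsh_cons q bX bX, qE_YX, qbrXX, add_zero, hz2]
  · rintro k (_ | m)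
    · simp [wYX, wpow, qsh_nil_right, qcons_single]
    · simp [wXY_succ, wYX_succ, qsh_cons q bY bX, qE_YX, qE_cons, qbrXX, qbrXY]
  · intro m
    simp [wXY, wpow, qsh_nil_left, qcons_single]
  · intro k; rfl
  · intro k m
    simp only [qsh_cons q bX bY, qE_YX, qbrYX, add_zero, hz]
  · intro k; rfl
  · intro m
    simp [wpow, qsh_nil_left, qcons_single]
  · intro k m
    simp [wYX_succ, qsh_cons q bY bY, qE_YX, qE_cons, qbrYY, qbrYX]

theorem part2 (hq : q ≠ 0) (n : ℕ) :
    ∑ t ∈ Finset.HasAntidiagonal.antidiagonal (n+2), (-1 : F)^t.1 • qsh q (wpow wXY t.2) (bX :: wpow wYX t.1) =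
      (-((1+(q^2)⁻¹)*(1+(q^2)⁻¹⁻¹))) • qcons F bX (qcons F bX (qcons F bY (qcons F bY
      (∑ t ∈ Finset.HasAntidiagonal.antidiagonal n, (-1 : F)^t.1 • qsh q (wpow wXY t.2) (bX :: wpow wYX t.1))))) := by
  have hz : q ^ (-2 : ℤ) = (q^2)⁻¹ := by rw [zpow_neg]; norm_cast
  have hz2 : q ^ (2 : ℤ) = q^2 := by norm_cast
  have hq2 := pow_ne_zero 2 hq
  refine absRec (qcons F bX) (qcons F bY) (q^2)⁻¹ (inv_ne_zero hq2)
    (fun k m => qsh q (wpow wXY m) (bX :: wpow wYX k))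
    (fun k m => qsh q (wpow wXY m) (wpow wYX k))
    (fun k m => match m with
      | 0 => 0
      | m+1 => q^2 • qsh q (bY :: wpow wXY m) (bX :: wpow wYX k))
    (fun k m => match m with
      | 0 => 0
      | m+1 => qsh q (bY :: wpow wXY m) (wpow wYX k))
    ?_ ?_ ?_ ?_ ?_ ?_ ?_ ?_ n
  · rintro k (_ | m)
    · simp [wpow, qsh_nil_left, qcons_single]
    · simp only [wXY_succ, qsh_cons q bX bX, qE_XY, qE_cons, qbrXX, qbrXY, map_smul, smul_smul,
        inv_mul_cancel₀ hq2]
      simp [add_comm]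
  · rintro k (_ | m)
    · simp [wYX, wpow, qsh_nil_left, qcons_single]
    · simp [wXY_succ, wYX_succ, qsh_cons q bX bY, qE_XY, qE_cons, qbrYY, qbrYX, add_comm]
  · intro m
    simp [wXY, wpow, qsh_nil_right, qcons_single]
  · intro k; rfl
  · intro k m
    simp only [qsh_cons q bY bX, qE_XY, qbrXY, add_zero, hz, smul_add, smul_smul, inv_inv,
      mul_inv_cancel₀ hq2, one_smul]
    rw [add_comm]
  · intro k; rfl
  · intro m
    simp [wpow, qsh_nil_right, qcons_single]
  · intro k m
    simp only [wYX_succ, qsh_cons q bY bY, qE_XY, qbrYY, add_zero, hz2, map_smul]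
    rw [add_comm]

end

/-- `Σ_{k=0}^{2n} (−1)^k W_{−k} ⋆ G̃_{2n−k} = (−1)^n [2]_q^{2n} (xxyy)^n x
     = Σ_{k=0}^{2n} (−1)^k G̃_{2n−k} ⋆ W_{−k}`, where `W_{−k} = (xy)^k x`, `G̃ₖ = (xy)^k`. -/
theorem stmt11 {F : Type*} [Field F] [CharZero F] (q : F) (hq : q ≠ 0)
    (hq1 : ∀ m : ℕ, 0 < m → q ^ m ≠ 1) (n : ℕ) :
    (∑ k ∈ Finset.range (2 * n + 1),
        ((-1 : F) ^ k) • qsh q (wpow wXY k ++ [bX]) (wpow wXY (2 * n - k))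
      = ((-1 : F) ^ n * (q + q⁻¹) ^ (2 * n)) •
          Finsupp.single (wpow wXXYY n ++ [bX]) (1 : F)) ∧
    (∑ k ∈ Finset.range (2 * n + 1),
        ((-1 : F) ^ k) • qsh q (wpow wXY (2 * n - k)) (wpow wXY k ++ [bX])
      = ((-1 : F) ^ n * (q + q⁻¹) ^ (2 * n)) •
          Finsupp.single (wpow wXXYY n ++ [bX]) (1 : F)) := by
  have e1 := finish q hq (q^2) (by field_simp; ring)
    (fun n => ∑ t ∈ Finset.HasAntidiagonal.antidiagonal n,
      (-1 : F)^t.1 • qsh q (bX :: wpow wYX t.1) (wpow wXY t.2))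
    (by simp [wpow, qsh_nil_right]) (part1 q hq) n
  have e2 := finish q hq (q^2)⁻¹ (by field_simp; ring)
    (fun n => ∑ t ∈ Finset.HasAntidiagonal.antidiagonal n,
      (-1 : F)^t.1 • qsh q (wpow wXY t.2) (bX :: wpow wYX t.1))
    (by simp [wpow, qsh_nil_left]) (part2 q hq) n
  simp only [Finset.Nat.sum_antidiagonal_eq_sum_range_succ_mk, ← wXY_snoc] at e1 e2
  exact ⟨e1, e2⟩
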